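/- Fix an integer q ≥ 5. Let a_n and b_n be the number of type-A and type-B vertices in row n of the hyperbolic Pascal triangle {4,q}, and let s_n = a_n + b_n + 2 be the total number of vertices of row n. Then each of the three sequences {a_n}, {b_n}, {s_n} satisfies the ternary homogeneous recurrence x_n = (q−1)·x_{n−1} − (q−1)·x_{n−2} + x_{n−3} for all n ≥ 4, and the initial values are a_1 = 0, a_2 = 1, a_3 = 2; b_1 = 0, b_2 = 0, b_3 = q−4; s_1 = 2, s_2 = 3, s_3 = q. -/

import Mathlib

/-- Type of a vertex in a hyperbolic Pascal triangle: winger, A, or B. -/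
inductive HVType where
  | W : HVType
  | A : HVType
  | B : HVType
deriving DecidableEq, Repr

/-- Number of type-B children produced by a vertex of the given type
in the hyperbolic Pascal triangle `{4,q}`. -/
def hBCount (q : ℕ) : HVType → ℕ
  | .A => q - 4
  | .B => q - 3
  | .W => 0

/-- The inner part of the next row: for each pair of consecutive vertices a shared
type-A child whose value is the sum of the parents' values, followed by the
type-B copies of the right parent. -/
def hMid (q : ℕ) : List (HVType × ℕ) → List (HVType × ℕ)
  | a :: b :: rest =>
      (HVType.A, a.2 + b.2) ::
        (List.replicate (hBCount q b.1) (HVType.B, b.2) ++ hMid q (b :: rest))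
  | _ => []

/-- Row `n` of the hyperbolic Pascal triangle `{4,q}`, as a list of
(type, value) pairs read from left to right. -/
def hRow (q : ℕ) : ℕ → List (HVType × ℕ)
  | 0 => [(HVType.W, 1)]
  | n + 1 => (HVType.W, 1) :: (hMid q (hRow q n) ++ [(HVType.W, 1)])

/-- Number of type-A vertices of row `n`. -/
def hCountA (q n : ℕ) : ℕ := ((hRow q n).filter (fun v => v.1 = HVType.A)).length

/-- Number of type-B vertices of row `n`. -/
def hCountB (q n : ℕ) : ℕ := ((hRow q n).filter (fun v => v.1 = HVType.B)).length

/-- Sum of the values of the type-A vertices of row `n`. -/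
def hSumA (q n : ℕ) : ℕ :=
  (((hRow q n).filter (fun v => v.1 = HVType.A)).map Prod.snd).sum

/-- Sum of the values of the type-B vertices of row `n`. -/
def hSumB (q n : ℕ) : ℕ :=
  (((hRow q n).filter (fun v => v.1 = HVType.B)).map Prod.snd).sum

/-- The number `s_n` of vertices of row `n`. -/
def hLen (q n : ℕ) : ℕ := (hRow q n).length

/-- The value of the `k`-th (0-indexed) vertex of row `n`. -/
def hVal (q n k : ℕ) : ℕ := ((hRow q n).getD k (HVType.W, 0)).2

/-- The type of the `k`-th (0-indexed) vertex of row `n`. -/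
def hType (q n k : ℕ) : HVType := ((hRow q n).getD k (HVType.W, 0)).1

/-- Total number of vertices of type `t` in a row. -/
def hCount (t : HVType) (l : List (HVType × ℕ)) : ℕ :=
  (l.filter (fun v => v.1 = t)).length

theorem length_eq_hCount_add (l : List (HVType × ℕ)) :
    l.length = hCount .W l + hCount .A l + hCount .B l := by
  induction l with
  | nil => rfl
  | cons a l ih =>
    obtain ⟨t, x⟩ := a
    cases t <;> simp [hCount] at ih ⊢ <;> omega

theorem hCount_W_hMid (q : ℕ) (a : HVType × ℕ) (l : List (HVType × ℕ)) :
    hCount .W (hMid q (a :: l)) = 0 := by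
  induction l generalizing a with
  | nil => simp [hMid, hCount]
  | cons b l ih => simpa [hMid, hCount] using ih b

theorem hCount_A_hMid (q : ℕ) (a : HVType × ℕ) (l : List (HVType × ℕ)) :
    hCount .A (hMid q (a :: l)) = l.length := by
  induction l generalizing a with
  | nil => simp [hMid, hCount]
  | cons b l ih => simpa [hMid, hCount] using ih b

theorem hCount_B_hMid (q : ℕ) (a : HVType × ℕ) (l : List (HVType × ℕ)) :
    hCount .B (hMid q (a :: l)) = (q - 4) * hCount .A l + (q - 3) * hCount .B l := by
  induction l generalizing a with
  | nil => simp [hMid, hCount]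
  | cons b l ih =>
    have := ih b
    obtain ⟨t, x⟩ := b
    cases t <;> simp [hMid, hCount, hBCount] at this ⊢ <;> rw [this] <;> ring

theorem hCount_cons_W_append_W (t : HVType) (l : List (HVType × ℕ)) (x y : ℕ) :
    hCount t ((.W, x) :: (l ++ [(.W, y)])) = hCount t l + if t = .W then 2 else 0 := by
  cases t <;> simp [hCount]

theorem exists_hRow_eq_cons (q n : ℕ) : ∃ l, hRow q n = (.W, 1) :: l := by
  cases n <;> simp [hRow]

theorem hLen_succ (q n : ℕ) : hLen q (n + 1) = hCountA q (n + 1) + hCountB q (n + 1) + 2 := by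
  have hW : hCount .W (hRow q (n + 1)) = 2 := by
    obtain ⟨l, hl⟩ := exists_hRow_eq_cons q n
    simp [hRow, hl, hCount_cons_W_append_W, hCount_W_hMid]
  have h := length_eq_hCount_add (hRow q (n + 1))
  simp only [hLen, hCountA, hCountB]
  simp only [hCount] at h hW
  omega

theorem hCountA_succ (q n : ℕ) : hCountA q (n + 1) + 1 = hLen q n := by
  obtain ⟨l, hl⟩ := exists_hRow_eq_cons q n
  change hCount .A (hRow q (n + 1)) + 1 = _
  simp [hLen, hRow, hl, hCount_cons_W_append_W, hCount_A_hMid]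

theorem hCountB_succ (q n : ℕ) :
    hCountB q (n + 1) = (q - 4) * hCountA q n + (q - 3) * hCountB q n := by
  obtain ⟨l, hl⟩ := exists_hRow_eq_cons q n
  change hCount .B (hRow q (n + 1)) =
    (q - 4) * hCount .A (hRow q n) + (q - 3) * hCount .B (hRow q n)
  simp only [hRow, hl, hCount_cons_W_append_W, hCount_B_hMid]
  simp [hCount]

/-- For `q ≥ 5`, the sequences `a_n`, `b_n` of numbers of type-A and
type-B vertices and the total number of vertices `s_n = a_n + b_n + 2` of row `n` of
the hyperbolic Pascal triangle `{4,q}` all satisfy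
`x_n = (q-1)x_{n-1} - (q-1)x_{n-2} + x_{n-3}` for `n ≥ 4`, with the stated
initial values. -/
theorem stmt_1 (q : ℕ) (hq : 5 ≤ q) :
    (∀ n, 1 ≤ n → hLen q n = hCountA q n + hCountB q n + 2) ∧
    (∀ n, 4 ≤ n →
      (hCountA q n : ℤ) = ((q : ℤ) - 1) * hCountA q (n - 1)
          - ((q : ℤ) - 1) * hCountA q (n - 2) + hCountA q (n - 3) ∧
      (hCountB q n : ℤ) = ((q : ℤ) - 1) * hCountB q (n - 1)
          - ((q : ℤ) - 1) * hCountB q (n - 2) + hCountB q (n - 3) ∧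
      (hLen q n : ℤ) = ((q : ℤ) - 1) * hLen q (n - 1)
          - ((q : ℤ) - 1) * hLen q (n - 2) + hLen q (n - 3)) ∧
    hCountA q 1 = 0 ∧ hCountA q 2 = 1 ∧ hCountA q 3 = 2 ∧
    hCountB q 1 = 0 ∧ hCountB q 2 = 0 ∧ hCountB q 3 = q - 4 ∧
    hLen q 1 = 2 ∧ hLen q 2 = 3 ∧ hLen q 3 = q := by
  obtain ⟨k, rfl⟩ := Nat.exists_eq_add_of_le hq
  have hA (n : ℕ) : hCountA (5 + k) (n + 2) =
      hCountA (5 + k) (n + 1) + hCountB (5 + k) (n + 1) + 1 := by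
    have h₁ : hCountA (5 + k) (n + 2) + 1 = _ := hCountA_succ (5 + k) (n + 1)
    have h₂ := hLen_succ (5 + k) n
    omega
  have hB (n : ℕ) : hCountB (5 + k) (n + 1) =
      (k + 1) * hCountA (5 + k) n + (k + 2) * hCountB (5 + k) n := by
    rw [hCountB_succ, show 5 + k - 4 = k + 1 by omega, show 5 + k - 3 = k + 2 by omega]
  have hA₁ : hCountA (5 + k) 1 = 0 := by simp [hCountA, hRow, hMid]
  have hB₁ : hCountB (5 + k) 1 = 0 := by simp [hCountB, hRow, hMid]
  have hA₂ : hCountA (5 + k) 2 = 1 := by rw [hA 0, hA₁, hB₁]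
  have hB₂ : hCountB (5 + k) 2 = 0 := by rw [hB 1, hA₁, hB₁]; simp
  have hA₃ : hCountA (5 + k) 3 = 2 := by rw [hA 1, hA₂, hB₂]
  have hB₃ : hCountB (5 + k) 3 = k + 1 := by rw [hB 2, hA₂, hB₂]; simp
  refine ⟨fun n hn => ?_, fun n hn => ?_, hA₁, hA₂, hA₃, hB₁, hB₂, ?_, ?_, ?_, ?_⟩
  · obtain ⟨m, rfl⟩ := Nat.exists_eq_add_of_le' hn
    exact hLen_succ _ m
  · obtain ⟨m, rfl⟩ := Nat.exists_eq_add_of_le' hn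
    rw [show m + 4 - 1 = m + 3 by omega, show m + 4 - 2 = m + 2 by omega,
      show m + 4 - 3 = m + 1 by omega]
    simp only [hLen_succ, hA, hB]
    push_cast
    refine ⟨?_, ?_, ?_⟩ <;> ring
  · omega
  · rw [hLen_succ, hA₁, hB₁]
  · rw [hLen_succ, hA₂, hB₂]
  · rw [hLen_succ, hA₃, hB₃]; omega
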